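/- Let ℕ-valued marks α_→e be assigned to the directed edges of a finite tree G with vertex capacities b and edge capacities c, and define S_→e(α) = [b_v − Σ_{→e' ∈ ∂→e} α_{→e'}]₀^{c_e} (clamped to [0, c_e]) where →e is outgoing from v and ∂→e is the set of edges directed into v other than the reversal of →e. Then the fixed-point equation α = S∘S(α) has a unique solution on a finite tree. -/

import Mathlib

/-- The message update `S` on integer marks of directed edges: for the edge from `v`
to `u`, clamp `b v` minus the sum of the incoming marks on the other edges at `v`
to the interval `[0, c v u]`. -/
def Sop {V : Type*} [Fintype V] [DecidableEq V] (G : SimpleGraph V)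
    [DecidableRel G.Adj] (b : V → ℕ) (c : V → V → ℕ) (α : V → V → ℕ) (v u : V) : ℕ :=
  min (c v u) (b v - ∑ w ∈ (G.neighborFinset v).erase u, α w v)

/-- The message update `Sop`, extended by zero off the edges of the graph. -/
def edgeUpdate {V : Type*} [Fintype V] [DecidableEq V] (G : SimpleGraph V)
    [DecidableRel G.Adj] (b : V → ℕ) (c : V → V → ℕ) (α : V → V → ℕ) (v u : V) : ℕ :=
  if G.Adj v u then Sop G b c α v u else 0

section edgeUpdate

variable {V : Type*} [Fintype V] [DecidableEq V] {G : SimpleGraph V} [DecidableRel G.Adj]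
  {b : V → ℕ} {c : V → V → ℕ}

theorem Sop_congr {α β : V → V → ℕ} {v u : V}
    (h : ∀ w, G.Adj w v → w ≠ u → α w v = β w v) : Sop G b c α v u = Sop G b c β v u := by
  unfold Sop
  rw [Finset.sum_congr rfl fun w hw => ?_]
  rw [Finset.mem_erase, SimpleGraph.mem_neighborFinset] at hw
  exact h w hw.2.symm hw.1

theorem Sop_edgeUpdate (α : V → V → ℕ) (v u : V) :
    Sop G b c (edgeUpdate G b c α) v u = Sop G b c (Sop G b c α) v u :=
  Sop_congr fun _ hw _ => if_pos hw

theorem edgeUpdate_edgeUpdate_eq_self_iff (α : V → V → ℕ) :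
    edgeUpdate G b c (edgeUpdate G b c α) = α ↔
      (∀ v u, ¬ G.Adj v u → α v u = 0) ∧
      ∀ v u, G.Adj v u → α v u = Sop G b c (Sop G b c α) v u := by
  constructor
  · intro h
    refine ⟨fun v u hvu => ?_, fun v u hvu => ?_⟩
    · rw [← h, edgeUpdate, if_neg hvu]
    · rw [← Sop_edgeUpdate]
      conv_lhs => rw [← h, edgeUpdate, if_pos hvu]
  · rintro ⟨h0, h1⟩
    funext v u
    by_cases hvu : G.Adj v u
    · rw [edgeUpdate, if_pos hvu, Sop_edgeUpdate, h1 v u hvu]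
    · rw [edgeUpdate, if_neg hvu, h0 v u hvu]

/-- Dependence of the `n`-th iterate on the initial marks propagates along a path of
length `n`. -/
theorem exists_isPath_of_iterate_edgeUpdate_ne (hG : G.IsAcyclic) (α β : V → V → ℕ) (n : ℕ)
    {v u : V} (hvu : G.Adj v u)
    (h : (edgeUpdate G b c)^[n] α v u ≠ (edgeUpdate G b c)^[n] β v u) :
    ∃ (x : V) (p : G.Walk x v), p.IsPath ∧ p.length = n ∧ u ∉ p.support := by
  induction n generalizing v u with
  | zero => exact ⟨v, .nil, .nil, rfl, by simpa using hvu.ne'⟩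
  | succ n ih =>
    rw [Function.iterate_succ_apply', Function.iterate_succ_apply', edgeUpdate, edgeUpdate,
      if_pos hvu, if_pos hvu] at h
    obtain ⟨w, hwv, hwu, hne⟩ : ∃ w, G.Adj w v ∧ w ≠ u ∧
        (edgeUpdate G b c)^[n] α w v ≠ (edgeUpdate G b c)^[n] β w v := by
      by_contra! hcon
      exact h (Sop_congr hcon)
    obtain ⟨x, p, hp, hlen, hv⟩ := ih hwv hne
    have hq := hp.concat hv hwv
    refine ⟨x, p.concat hwv, hq, by simp [hlen], fun hu => hwu ?_⟩
    rw [hG.eq_penultimate_of_adj_end hq hvu hu, SimpleGraph.Walk.penultimate_concat]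

theorem iterate_edgeUpdate_eq (hG : G.IsAcyclic) (α β : V → V → ℕ) {n : ℕ}
    (hn : Fintype.card V < n) :
    (edgeUpdate G b c)^[n] α = (edgeUpdate G b c)^[n] β := by
  funext v u
  by_cases hvu : G.Adj v u
  · by_contra h
    obtain ⟨x, p, hp, hlen, -⟩ := exists_isPath_of_iterate_edgeUpdate_ne hG α β n hvu h
    have := hp.length_lt
    omega
  · obtain ⟨m, rfl⟩ := Nat.exists_eq_succ_of_ne_zero (Nat.ne_zero_of_lt hn)
    rw [Function.iterate_succ_apply', Function.iterate_succ_apply', edgeUpdate, edgeUpdate,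
      if_neg hvu, if_neg hvu]

end edgeUpdate

theorem tree_unique_fixed_point {V : Type*} [Fintype V] [DecidableEq V]
    (G : SimpleGraph V) [DecidableRel G.Adj] (hG : G.IsTree)
    (b : V → ℕ) (c : V → V → ℕ) :
    ∃! α : V → V → ℕ,
      (∀ v u, ¬ G.Adj v u → α v u = 0) ∧
      ∀ v u, G.Adj v u → α v u = Sop G b c (Sop G b c α) v u := by
  simp only [← edgeUpdate_edgeUpdate_eq_self_iff]
  set T := edgeUpdate G b c
  set n := Fintype.card V + 1
  have hconst : ∀ {m : ℕ}, n ≤ m → ∀ α β, T^[m] α = T^[m] β := fun hm α β =>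
    iterate_edgeUpdate_eq hG.isAcyclic α β hm
  have hfix : T (T^[n] 0) = T^[n] 0 := by
    rw [← Function.iterate_succ_apply' T, Function.iterate_succ_apply]
    exact hconst le_rfl _ _
  refine ⟨T^[n] 0, by simp only [hfix], fun α hα => ?_⟩
  have hper : T^[2 * n] α = α := by
    rw [Function.iterate_mul]
    exact Function.iterate_fixed hα n
  rw [← hper, hconst (by omega) α (T^[n] 0), Function.iterate_fixed hfix]
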